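/- Consider a finite two-agent Markov game with state set S, action sets A_P and A_A, reward r, transition kernel P and discount γ ∈ [0,1). Let u : ℝ → ℝ satisfy the slope condition with constants 0 < ε₀ ≤ L, let x₀ ∈ ℝ, write ũ(x) = u(x) − x₀, and let 0 < α ≤ min(1/L, 1). Define the operator H on joint Q-functions by (Hq)(s,a_P,a_A) = α·∑_{s'} P(s'|s,a_P,a_A)·ũ( r(s,a_P,a_A) + γ·max_{b_P,b_A} q(s',b_P,b_A) − q(s,a_P,a_A) ) + q(s,a_P,a_A). Then H is a contraction in the sup-norm with modulus 1 − α(1−γ)ε₀: ‖Hq − Hq'‖_∞ ≤ (1 − α(1−γ)ε₀)·‖q − q'‖_∞ for all q, q'. -/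

import Mathlib

open Finset

/-- Sup-norm on joint Q-functions over a finite state and joint-action space. -/
noncomputable def supNormQ2 {S AP AA : Type} [Fintype S] [Fintype AP] [Fintype AA]
    [Nonempty S] [Nonempty AP] [Nonempty AA]
    (f : S → AP → AA → ℝ) : ℝ :=
  ⨆ p : S × AP × AA, |f p.1 p.2.1 p.2.2|

/-- `u` has slopes between `ε₀` and `L`. -/
def SlopeCondition (u : ℝ → ℝ) (ε₀ L : ℝ) : Prop :=
  ∀ x y : ℝ, x ≠ y → ε₀ ≤ (u x - u y) / (x - y) ∧ (u x - u y) / (x - y) ≤ L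

/-- The risk-sensitive joint Q-learning operator
`(Hq)(s,a_P,a_A) = α·∑_{s'} P(s'|s,a_P,a_A)·ũ(r(s,a_P,a_A) + γ·max_{b_P,b_A} q(s',b_P,b_A) − q(s,a_P,a_A)) + q(s,a_P,a_A)`,
where `ũ(x) = u(x) − x₀`. -/
noncomputable def riskJointOp {S AP AA : Type} [Fintype S] [Fintype AP] [Fintype AA]
    [Nonempty AP] [Nonempty AA]
    (r : S → AP → AA → ℝ) (P : S → AP → AA → S → ℝ) (γ : ℝ)
    (u : ℝ → ℝ) (x₀ α : ℝ)
    (q : S → AP → AA → ℝ) : S → AP → AA → ℝ :=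
  fun s aP aA =>
    α * ∑ s', P s aP aA s' *
        (u (r s aP aA + γ * (⨆ b : AP × AA, q s' b.1 b.2) - q s aP aA) - x₀)
      + q s aP aA

/-- Under the slope condition, the increments of `u` are multiples of the increments of its
argument with a factor in `[ε₀, L]`. -/
theorem SlopeCondition.exists_slope {u : ℝ → ℝ} {ε₀ L : ℝ} (hu : SlopeCondition u ε₀ L)
    (h : ε₀ ≤ L) (x y : ℝ) : ∃ ξ, ε₀ ≤ ξ ∧ ξ ≤ L ∧ u x - u y = ξ * (x - y) := by
  rcases eq_or_ne x y with rfl | hxy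
  · exact ⟨ε₀, le_rfl, h, by simp⟩
  · exact ⟨_, (hu x y hxy).1, (hu x y hxy).2, (div_mul_cancel₀ _ (sub_ne_zero.2 hxy)).symm⟩

theorem SlopeCondition.abs_update_sub_le {u : ℝ → ℝ} {ε₀ L γ α D : ℝ}
    (hu : SlopeCondition u ε₀ L) (hε₀L : ε₀ ≤ L) (hε₀ : 0 < ε₀) (hγ0 : 0 ≤ γ) (hγ1 : γ < 1)
    (hα0 : 0 < α) (hαL : α * L ≤ 1) (ρ : ℝ) {m m' d d' : ℝ}
    (hm : |m - m'| ≤ D) (hd : |d - d'| ≤ D) :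
    |α * (u (ρ + γ * m - d) - u (ρ + γ * m' - d')) + (d - d')|
      ≤ (1 - α * (1 - γ) * ε₀) * D := by
  obtain ⟨ξ, hξ0, hξL, hξ⟩ := hu.exists_slope hε₀L (ρ + γ * m - d) (ρ + γ * m' - d')
  have hD : 0 ≤ D := (abs_nonneg _).trans hm
  have hξα : α * ξ ≤ 1 := (mul_le_mul_of_nonneg_left hξL hα0.le).trans hαL
  have hc : 0 ≤ α * ξ * γ := by have := hε₀.trans_le hξ0; positivity
  calc |α * (u (ρ + γ * m - d) - u (ρ + γ * m' - d')) + (d - d')|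
      = |α * ξ * γ * (m - m') + (1 - α * ξ) * (d - d')| := by rw [hξ]; ring_nf
    _ ≤ |α * ξ * γ * (m - m')| + |(1 - α * ξ) * (d - d')| := abs_add_le _ _
    _ = α * ξ * γ * |m - m'| + (1 - α * ξ) * |d - d'| := by
        rw [abs_mul (α * ξ * γ), abs_mul (1 - α * ξ), abs_of_nonneg hc, abs_of_nonneg (sub_nonneg.2 hξα)]
    _ ≤ α * ξ * γ * D + (1 - α * ξ) * D := by
        gcongr
    _ = (1 - α * (1 - γ) * ξ) * D := by ring
    _ ≤ (1 - α * (1 - γ) * ε₀) * D := by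
        have : 0 ≤ α * (1 - γ) := mul_nonneg hα0.le (sub_nonneg.2 hγ1.le)
        gcongr

/-- The maximum over a finite nonempty type is nonexpansive for the sup-distance. -/
theorem abs_ciSup_sub_ciSup_le {ι : Type*} [Finite ι] [Nonempty ι] {f g : ι → ℝ} {D : ℝ}
    (h : ∀ i, |f i - g i| ≤ D) : |(⨆ i, f i) - ⨆ i, g i| ≤ D := by
  have hf := Finite.bddAbove_range f
  have hg := Finite.bddAbove_range g
  rw [abs_sub_le_iff, sub_le_iff_le_add, sub_le_iff_le_add]
  constructor <;> refine ciSup_le fun i => ?_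
  · linarith [(abs_le.1 (h i)).2, le_ciSup hg i]
  · linarith [(abs_le.1 (h i)).1, le_ciSup hf i]

theorem abs_le_supNormQ2 {S AP AA : Type} [Fintype S] [Fintype AP] [Fintype AA]
    [Nonempty S] [Nonempty AP] [Nonempty AA] (f : S → AP → AA → ℝ) (s : S) (a : AP) (b : AA) :
    |f s a b| ≤ supNormQ2 f :=
  le_ciSup (f := fun p : S × AP × AA => |f p.1 p.2.1 p.2.2|) (Finite.bddAbove_range _) (s, a, b)

/-- The risk-sensitive joint Q-learning operator `H` is a sup-norm
contraction with modulus `1 − α(1−γ)ε₀`. -/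
theorem riskJointOp_contraction
    {S AP AA : Type} [Fintype S] [Fintype AP] [Fintype AA]
    [Nonempty S] [Nonempty AP] [Nonempty AA]
    (r : S → AP → AA → ℝ) (P : S → AP → AA → S → ℝ)
    (hP_nonneg : ∀ s aP aA s', 0 ≤ P s aP aA s')
    (hP_sum : ∀ s aP aA, ∑ s', P s aP aA s' = 1)
    (γ : ℝ) (hγ0 : 0 ≤ γ) (hγ1 : γ < 1)
    (u : ℝ → ℝ) (ε₀ L : ℝ) (hε₀ : 0 < ε₀) (hε₀L : ε₀ ≤ L)
    (hu : SlopeCondition u ε₀ L)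
    (x₀ : ℝ) (α : ℝ) (hα0 : 0 < α) (hα1 : α ≤ min (1 / L) 1) :
    ∀ q q' : S → AP → AA → ℝ,
      supNormQ2 (fun s aP aA =>
          riskJointOp r P γ u x₀ α q s aP aA - riskJointOp r P γ u x₀ α q' s aP aA)
        ≤ (1 - α * (1 - γ) * ε₀) * supNormQ2 (fun s aP aA => q s aP aA - q' s aP aA) := by
  intro q q'
  have hαL : α * L ≤ 1 :=
    (le_div_iff₀ (hε₀.trans_le hε₀L)).1 (hα1.trans (min_le_left _ _))
  have hq := abs_le_supNormQ2 fun s aP aA => q s aP aA - q' s aP aA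
  refine ciSup_le fun ⟨s, aP, aA⟩ => ?_
  dsimp only
  set D := supNormQ2 fun s aP aA => q s aP aA - q' s aP aA
  set M : S → ℝ := fun s' => ⨆ b : AP × AA, q s' b.1 b.2
  set M' : S → ℝ := fun s' => ⨆ b : AP × AA, q' s' b.1 b.2
  have hM (s' : S) : |M s' - M' s'| ≤ D := abs_ciSup_sub_ciSup_le fun b => hq s' b.1 b.2
  have average : riskJointOp r P γ u x₀ α q s aP aA - riskJointOp r P γ u x₀ α q' s aP aA
      = ∑ s', P s aP aA s' *
          (α * (u (r s aP aA + γ * M s' - q s aP aA) - u (r s aP aA + γ * M' s' - q' s aP aA))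
            + (q s aP aA - q' s aP aA)) := by
    simp only [riskJointOp, mul_add, mul_sub, sum_add_distrib, sum_sub_distrib, ← sum_mul,
      hP_sum, mul_left_comm _ α, ← mul_sum]
    ring
  rw [average]
  calc _ ≤ ∑ s', |P s aP aA s' *
          (α * (u (r s aP aA + γ * M s' - q s aP aA) - u (r s aP aA + γ * M' s' - q' s aP aA))
            + (q s aP aA - q' s aP aA))| := abs_sum_le_sum_abs _ _
    _ ≤ ∑ s', P s aP aA s' * ((1 - α * (1 - γ) * ε₀) * D) := by
        refine sum_le_sum fun s' _ => ?_
        rw [abs_mul, abs_of_nonneg (hP_nonneg s aP aA s')]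
        exact mul_le_mul_of_nonneg_left
          (hu.abs_update_sub_le hε₀L hε₀ hγ0 hγ1 hα0 hαL _ (hM s') (hq s aP aA))
          (hP_nonneg s aP aA s')
    _ = (1 - α * (1 - γ) * ε₀) * D := by rw [← sum_mul, hP_sum, one_mul]
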